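/- For all integers n and i with 1 ≤ i ≤ n−1, the set Dis(n+2,i) of dissections of an (n+2)-gon with i chords and the set Skyt(n−i+1, i, 2) of skew standard Young tableaux have the same cardinality. -/

import Mathlib

/-! ## Skew Young tableaux -/

/-- Cells (row, col), 0-indexed, of the skew diagram with `b-2` single cells in
column `i` on top, two full rows of length `i+1`, and `a-2` single cells in column `0` below. -/
def skytCells (a i b : ℕ) : Finset (ℕ × ℕ) :=
  (Finset.range (a + b - 2) ×ˢ Finset.range (i + 1)).filter fun c =>
    (c.1 + 2 < b → c.2 = i) ∧ (b ≤ c.1 → c.2 = 0)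

/-- Skew standard Young tableaux of shape `[(i+1)^b, 1^(a-2)] / [(i-1)^(b-2)]`,
modelled as fillings of `skytCells a i b` by `1, …, a+b+2i-2`, increasing along
rows and columns, and vanishing outside the diagram. -/
def SkytSet (a i b : ℕ) : Set ((ℕ × ℕ) → ℕ) :=
  {f | (∀ c, c ∉ skytCells a i b → f c = 0) ∧
    Set.BijOn f (skytCells a i b : Set (ℕ × ℕ)) (Finset.Icc 1 (a + b + 2 * i - 2) : Set ℕ) ∧
    (∀ c ∈ skytCells a i b, ∀ d ∈ skytCells a i b, c.1 = d.1 → c.2 < d.2 → f c < f d) ∧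
    (∀ c ∈ skytCells a i b, ∀ d ∈ skytCells a i b, c.2 = d.2 → c.1 < d.1 → f c < f d)}

/-! ## Dyck paths -/

/-- Lengths of the maximal ascents (runs of `true`) of a word. -/
def ascentLengths (w : List Bool) : List ℕ :=
  ((w.splitBy (· == ·)).filter fun r => r.headD false).map List.length

/-- `DyckSet n l s`: Dyck paths (`true` = up-step) of semilength `n` with exactly `l`
long ascents, exactly `s` singletons, and no singleton after the last long ascent. -/
def DyckSet (n l s : ℕ) : Set (List Bool) :=
  {w | w.length = 2 * n ∧ w.count true = w.count false ∧
    (∀ p, p <+: w → p.count false ≤ p.count true) ∧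
    ((ascentLengths w).filter fun x => decide (2 ≤ x)).length = l ∧
    ((ascentLengths w).filter fun x => decide (x = 1)).length = s ∧
    ∀ j, (ascentLengths w).getD j 0 = 1 → ∃ k, j < k ∧ 2 ≤ (ascentLengths w).getD k 0}

/-! ## Dissections and triangulations -/

/-- A chord of the convex `n`-gon (vertices `1, …, n` counterclockwise): a pair of
non-adjacent vertices, recorded with the smaller endpoint first. -/
def IsChord (n : ℕ) (c : ℕ × ℕ) : Prop :=
  1 ≤ c.1 ∧ c.1 + 1 < c.2 ∧ c.2 ≤ n ∧ ¬(c.1 = 1 ∧ c.2 = n)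

/-- Two chords cross in the interior of the polygon. -/
def Crosses (c d : ℕ × ℕ) : Prop :=
  (c.1 < d.1 ∧ d.1 < c.2 ∧ c.2 < d.2) ∨ (d.1 < c.1 ∧ c.1 < d.2 ∧ d.2 < c.2)

/-- A dissection of the `n`-gon: a set of pairwise non-crossing chords. -/
def IsDissection (n : ℕ) (S : Finset (ℕ × ℕ)) : Prop :=
  (∀ c ∈ S, IsChord n c) ∧ (∀ c ∈ S, ∀ d ∈ S, c ≠ d → ¬Crosses c d)

/-- `DisSet n k`: dissections of the `n`-gon with exactly `k` chords. -/
def DisSet (n k : ℕ) : Set (Finset (ℕ × ℕ)) :=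
  {S | IsDissection n S ∧ S.card = k}

/-- A triangulation of the `n`-gon: a maximal set of pairwise non-crossing chords. -/
def IsTriangulation (n : ℕ) (S : Finset (ℕ × ℕ)) : Prop :=
  IsDissection n S ∧ ∀ c, IsChord n c → (∀ d ∈ S, ¬Crosses c d) → c ∈ S

/-- Fuelled recursive computation of the fan decomposition of the triangulation induced by
the chord set `S` on the vertex interval `[p, r]`: returns the list of pairs
(origin of fan, number of triangles of the fan), in the order of the recursive
fan decomposition (fan at the smallest vertex first, then the decompositions of the
sub-polygons in counterclockwise order). -/
def fanListAux (S : Finset (ℕ × ℕ)) : ℕ → ℕ → ℕ → List (ℕ × ℕ)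
  | 0, _, _ => []
  | fuel + 1, p, r =>
    if r ≤ p + 1 then []
    else
      let ws := ((S.filter fun c => c.1 = p ∧ p + 1 < c.2 ∧ c.2 < r).image Prod.snd).sort (· ≤ ·)
      let link := (p + 1) :: (ws ++ [r])
      (p, ws.length + 1) :: (link.zip link.tail).flatMap fun q => fanListAux S fuel q.1 q.2

/-- The fan decomposition `F(T)` of the triangulation `S` of the polygon on the vertex
interval `[p, r]`, as a list of (origin, fan size) pairs. -/
def fanList (S : Finset (ℕ × ℕ)) (p r : ℕ) : List (ℕ × ℕ) :=
  fanListAux S (r - p) p r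

/-- The sequence `δ(T) = (d_1, …, d_{k-1})` of differences of consecutive fan origins. -/
def deltaList (L : List (ℕ × ℕ)) : List ℕ :=
  ((L.map Prod.fst).zip (L.map Prod.fst).tail).map fun q => q.2 - q.1

/-- `TriSet n t s`: triangulations of the `n`-gon whose fan decomposition has `t + s` fans,
exactly `s` of them singular, the last one not singular. -/
def TriSet (n t s : ℕ) : Set (Finset (ℕ × ℕ)) :=
  {S | IsTriangulation n S ∧
    (fanList S 1 n).length = t + s ∧
    ((fanList S 1 n).filter fun fan => decide (fan.2 = 1)).length = s ∧
    ((fanList S 1 n).getLastD (0, 0)).2 ≠ 1}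

/-! ## Ordered set partitions -/

/-- The minimum of a finite set of naturals (0 by convention for `∅`). -/
def blockMin (A : Finset ℕ) : ℕ := (A.sort (· ≤ ·)).getD 0 0

/-- The second-smallest element of a finite set of naturals. -/
def blockSndMin (A : Finset ℕ) : ℕ := (A.sort (· ≤ ·)).getD 1 0

/-- An ordered set partition of `{1, …, n}` : a list of nonempty pairwise disjoint
blocks whose union is `{1, …, n}`. -/
def IsOSP (n : ℕ) (L : List (Finset ℕ)) : Prop :=
  (∀ A ∈ L, A.Nonempty) ∧ List.Pairwise Disjoint L ∧
    L.foldr (· ∪ ·) ∅ = Finset.Icc 1 n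

/-- Nomincreasing: the blocks' minima strictly increase, and the second-smallest elements
of the blocks of size at least 2 strictly increase (in the order the blocks appear). -/
def Nomincreasing (L : List (Finset ℕ)) : Prop :=
  (L.map blockMin).Chain' (· < ·) ∧
    ((L.filter fun A => decide (2 ≤ A.card)).map blockSndMin).Chain' (· < ·)

/-- The word `U^{a_1} D^{x_2-x_1} ⋯ U^{a_t} D^{n-x_t+x_1}` attached to an ordered set
partition of `{1, …, n}` with minima `x_j` and block sizes `a_j`. -/
def ospWord (n : ℕ) (L : List (Finset ℕ)) : List Bool :=
  let xs := L.map blockMin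
  let ds := ((xs.zip xs.tail).map fun q => q.2 - q.1) ++ [n - xs.getLastD 0 + xs.headD 0]
  ((L.map Finset.card).zip ds).flatMap fun q =>
    List.replicate q.1 true ++ List.replicate q.2 false

/-! ## The map `Nom` -/

/-- The `j`-th block (0-indexed) of `Nom(λ)` for a tableau `f ∈ SkytSet a i b`. -/
def nomBlock (a i b : ℕ) (f : ℕ × ℕ → ℕ) (j : ℕ) : Finset ℕ :=
  let N := a + b + 2 * i - 2
  let X := ((skytCells a i b).filter fun c => c.1 + 1 < b).image f
  let x := (X.sort (· ≤ ·)).getD j 0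
  let row := (Finset.range (i + 1)).filter fun c => f (b - 2, c) = x
  if row.Nonempty then
    let col := (row.sort (· ≤ ·)).getD 0 0
    if col = i then insert x (Finset.Icc (f (b - 1, col)) N \ X)
    else insert x (Finset.Icc (f (b - 1, col)) (f (b - 1, col + 1) - 1) \ X)
  else {x}

/-- The nomincreasing ordered set partition `Nom(λ)` of a tableau `λ ∈ SkytSet a i b`. -/
def Nom (a i b : ℕ) (f : ℕ × ℕ → ℕ) : List (Finset ℕ) :=
  (List.range (i + b - 1)).map (nomBlock a i b f)

/-- The Dyck word `U^{u_1} D^{d_1} ⋯ U^{u_{t+s}} D^{d_{t+s}}` attached to a triangulation. -/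
def triWord (n : ℕ) (S : Finset (ℕ × ℕ)) : List Bool :=
  let L := fanList S 1 n
  let xs := L.map Prod.fst
  let ds := deltaList L ++ [n - xs.getLastD 0 + xs.headD 0 - 2]
  ((L.map Prod.snd).zip ds).flatMap fun q =>
    List.replicate q.1 true ++ List.replicate q.2 false

/-! ## Schröder trees -/

/-- Plane trees encoding Schröder words: `level` stands for a level step, and `hill` for an
up-step together with the matching down-step. -/
inductive SchroderTree
  | nil : SchroderTree
  | level : SchroderTree → SchroderTree
  | hill : SchroderTree → SchroderTree → SchroderTree

namespace SchroderTree

/-- Number of nodes. -/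
def size : SchroderTree → ℕ
  | nil => 0
  | level t => t.size + 1
  | hill s t => s.size + t.size + 1

/-- Number of `hill` nodes. -/
def hills : SchroderTree → ℕ
  | nil => 0
  | level t => t.hills
  | hill s t => s.hills + t.hills + 1

/-- The last-child spine contains no `level` node. -/
def Steep : SchroderTree → Prop
  | nil => True
  | level _ => False
  | hill _ t => t.Steep

/-- The non-crossing family of chords encoded by a tree, on the polygon with vertices
`p, v, v + 1, …, v + t.size`. -/
def chords : SchroderTree → ℕ → ℕ → Finset (ℕ × ℕ)
  | nil, _, _ => ∅
  | level t, _, v => t.chords v (v + 1)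
  | hill s t, p, v =>
    insert (p, v + s.size + 1) (s.chords v (v + 1) ∪ t.chords p (v + s.size + 1))

end SchroderTree

/-- Non-crossing families of chords of the polygon with vertices `p, v, v + 1, …, q`, where
the side `(p, q)` counts as a chord. -/
def IsChordFamily (p v q : ℕ) (S : Finset (ℕ × ℕ)) : Prop :=
  (∀ c ∈ S, (c.1 = p ∧ v < c.2 ∨ v ≤ c.1 ∧ c.1 + 1 < c.2) ∧ c.2 ≤ q) ∧
    ∀ c ∈ S, ∀ d ∈ S, ¬Crosses c d

namespace SchroderTree

theorem mem_chords_bounds (t : SchroderTree) {p v : ℕ} {c : ℕ × ℕ} (hc : c ∈ t.chords p v) :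
    (c.1 = p ∧ v < c.2 ∨ v ≤ c.1 ∧ c.1 + 1 < c.2) ∧ c.2 ≤ v + t.size := by
  induction t generalizing p v with
  | nil => simp [chords] at hc
  | level t ih =>
    have := ih hc
    simp only [size]
    omega
  | hill s t ihs iht =>
    simp only [chords, Finset.mem_insert, Finset.mem_union] at hc
    simp only [size]
    rcases hc with rfl | hc | hc
    · exact ⟨Or.inl ⟨rfl, by dsimp only; omega⟩, by dsimp only; omega⟩
    · have := ihs hc
      omega
    · have := iht hc
      omega

theorem isChordFamily_chords (t : SchroderTree) {p v : ℕ} (hpv : p < v) :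
    IsChordFamily p v (v + t.size) (t.chords p v) := by
  refine ⟨fun c hc => t.mem_chords_bounds hc, ?_⟩
  induction t generalizing p v with
  | nil => simp [chords]
  | level t ih => exact ih (Nat.lt_succ_self v)
  | hill s t ihs iht =>
    intro c hc d hd
    have hs := fun x hx => s.mem_chords_bounds (p := v) (v := v + 1) (c := x) hx
    have ht := fun x hx => t.mem_chords_bounds (p := p) (v := v + s.size + 1) (c := x) hx
    simp only [chords, Finset.mem_insert, Finset.mem_union] at hc hd
    rcases hc with rfl | hc | hc <;> rcases hd with rfl | hd | hd
    · simp [Crosses]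
    · have := hs _ hd; simp only [Crosses]; omega
    · have := ht _ hd; simp only [Crosses]; omega
    · have := hs _ hc; simp only [Crosses]; omega
    · exact ihs (Nat.lt_succ_self v) c hc d hd
    · have := hs _ hc; have := ht _ hd; simp only [Crosses]; omega
    · have := ht _ hc; simp only [Crosses]; omega
    · have := ht _ hc; have := hs _ hd; simp only [Crosses]; omega
    · exact iht (by omega) c hc d hd

theorem card_chords (t : SchroderTree) {p v : ℕ} (hpv : p < v) :
    (t.chords p v).card = t.hills := by
  induction t generalizing p v with
  | nil => rfl
  | level t ih => exact ih (Nat.lt_succ_self v)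
  | hill s t ihs iht =>
    have hs := fun x hx => s.mem_chords_bounds (p := v) (v := v + 1) (c := x) hx
    have ht := fun x hx => t.mem_chords_bounds (p := p) (v := v + s.size + 1) (c := x) hx
    rw [chords, Finset.card_insert_of_notMem, Finset.card_union_of_disjoint,
      ihs (Nat.lt_succ_self v), iht (by omega), hills]
    · rw [Finset.disjoint_left]
      intro c hc hc'
      have := hs c hc
      have := ht c hc'
      omega
    · rw [Finset.mem_union, not_or]
      refine ⟨fun h => ?_, fun h => ?_⟩
      · have := hs _ h
        simp only at this
        omega
      · have := ht _ h
        simp only at this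
        omega

theorem chords_hill_left (s t : SchroderTree) {p v : ℕ} (hpv : p < v) :
    s.chords v (v + 1) =
      ((hill s t).chords p v).filter fun c => v ≤ c.1 ∧ c.2 ≤ v + s.size + 1 := by
  ext c
  have hs := fun hx => s.mem_chords_bounds (p := v) (v := v + 1) (c := c) hx
  have ht := fun hx => t.mem_chords_bounds (p := p) (v := v + s.size + 1) (c := c) hx
  simp only [chords, Finset.mem_filter, Finset.mem_insert, Finset.mem_union]
  constructor
  · intro h
    have := hs h
    exact ⟨Or.inr (Or.inl h), by omega⟩
  · rintro ⟨rfl | h | h, h'⟩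
    · simp only at h'
      omega
    · exact h
    · have := ht h
      omega

theorem chords_hill_right (s t : SchroderTree) {p v : ℕ} :
    t.chords p (v + s.size + 1) =
      ((hill s t).chords p v).filter fun c => v + s.size + 1 < c.2 := by
  ext c
  have hs := fun hx => s.mem_chords_bounds (p := v) (v := v + 1) (c := c) hx
  have ht := fun hx => t.mem_chords_bounds (p := p) (v := v + s.size + 1) (c := c) hx
  simp only [chords, Finset.mem_filter, Finset.mem_insert, Finset.mem_union]
  constructor
  · intro h
    have := ht h
    exact ⟨Or.inr (Or.inr h), by omega⟩
  · rintro ⟨rfl | h | h, h'⟩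
    · simp only at h'
      omega
    · have := hs h
      omega
    · exact h

theorem mem_chords_hill (s t : SchroderTree) (p v : ℕ) :
    (p, v + s.size + 1) ∈ (hill s t).chords p v := by
  simp [chords]

theorem le_of_mem_chords_hill (s t : SchroderTree) {p v w : ℕ} (hpv : p < v)
    (h : (p, w) ∈ (hill s t).chords p v) : v + s.size + 1 ≤ w := by
  simp only [chords, Finset.mem_insert, Finset.mem_union, Prod.mk.injEq, true_and] at h
  rcases h with rfl | h | h
  · exact le_rfl
  · have := s.mem_chords_bounds h
    simp only at this
    omega
  · have := t.mem_chords_bounds h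
    simp only at this
    omega

theorem notMem_chords_level (t : SchroderTree) {p v w : ℕ} (hpv : p < v) :
    (p, w) ∉ (level t).chords p v := by
  intro h
  have := t.mem_chords_bounds (p := v) (v := v + 1) h
  simp only at this
  omega

theorem chords_injective (t t' : SchroderTree) {p v : ℕ} (hpv : p < v)
    (hsize : t.size = t'.size) (h : t.chords p v = t'.chords p v) : t = t' := by
  induction t generalizing t' p v with
  | nil => cases t' <;> simp_all [size]
  | level t ih =>
    cases t' with
    | nil => simp [size] at hsize
    | level t' =>
      rw [ih t' (Nat.lt_succ_self v) (by simpa [size] using hsize) h]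
    | hill s' t' =>
      exact absurd (h ▸ mem_chords_hill s' t' p v) (notMem_chords_level t hpv)
  | hill s t ihs iht =>
    cases t' with
    | nil => simp [size] at hsize
    | level t' =>
      exact absurd (h ▸ mem_chords_hill s t p v) (notMem_chords_level t' hpv)
    | hill s' t' =>
      have h₁ := le_of_mem_chords_hill s t hpv (h ▸ mem_chords_hill s' t' p v)
      have h₂ := le_of_mem_chords_hill s' t' hpv (h ▸ mem_chords_hill s t p v)
      have hs : s.size = s'.size := by omega
      have ht : t.size = t'.size := by simp only [size] at hsize; omega
      have e₁ := chords_hill_left s t hpv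
      have e₂ := chords_hill_right s t (p := p) (v := v)
      rw [h, hs, ← chords_hill_left s' t' hpv] at e₁
      rw [h, hs, ← chords_hill_right s' t'] at e₂
      rw [ihs s' (Nat.lt_succ_self v) hs e₁, iht t' (by omega) ht e₂]

theorem exists_chords_eq (m : ℕ) {p v : ℕ} {S : Finset (ℕ × ℕ)} (hpv : p < v)
    (hS : IsChordFamily p v (v + m) S) : ∃ t : SchroderTree, t.size = m ∧ t.chords p v = S := by
  induction m using Nat.strong_induction_on generalizing p v S with
  | _ m ih =>
  obtain ⟨hb, hx⟩ := hS
  by_cases hm : m = 0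
  · refine ⟨nil, hm.symm, ?_⟩
    symm
    rw [chords, Finset.eq_empty_iff_forall_notMem]
    intro c hc
    have := hb c hc
    omega
  by_cases hp : ∃ w, (p, w) ∈ S
  · classical
    have hw := Nat.find_spec hp
    have hmin : ∀ c ∈ S, c.1 = p → Nat.find hp ≤ c.2 := fun c hc h =>
      Nat.find_min' hp (by rw [← h]; exact hc)
    set w := Nat.find hp
    have hwb := hb _ hw
    simp only at hwb
    obtain ⟨k, hk⟩ : ∃ k, w = v + k + 1 := ⟨w - v - 1, by omega⟩
    obtain ⟨s, hs, hs'⟩ := ih k (by omega) (p := v) (v := v + 1)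
      (S := S.filter fun c => v ≤ c.1 ∧ c.2 ≤ w) (by omega) (by
        refine ⟨fun c hc => ?_, fun c hc d hd =>
          hx c (Finset.mem_filter.1 hc).1 d (Finset.mem_filter.1 hd).1⟩
        have := hb c (Finset.mem_filter.1 hc).1
        have := (Finset.mem_filter.1 hc).2
        omega)
    obtain ⟨t, ht, ht'⟩ := ih (m - k - 1) (by omega) (p := p) (v := w)
      (S := S.filter fun c => w < c.2) (by omega) (by
        refine ⟨fun c hc => ?_, fun c hc d hd =>
          hx c (Finset.mem_filter.1 hc).1 d (Finset.mem_filter.1 hd).1⟩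
        have := hb c (Finset.mem_filter.1 hc).1
        have := (Finset.mem_filter.1 hc).2
        have := hx _ (Finset.mem_filter.1 hc).1 _ hw
        simp only [Crosses] at this
        omega)
    refine ⟨hill s t, by simp only [size]; omega, ?_⟩
    rw [chords, hs, ← hk, hs', ht']
    ext c
    simp only [Finset.mem_insert, Finset.mem_union, Finset.mem_filter]
    constructor
    · rintro (rfl | h | h)
      exacts [hw, h.1, h.1]
    · intro hc
      have h₁ := hb c hc
      have h₂ := hmin c hc
      by_cases h : c.1 = p ∧ c.2 = w
      · exact Or.inl (Prod.ext h.1 h.2)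
      · right
        simp only [hc, true_and]
        omega
  · obtain ⟨t, ht, ht'⟩ := ih (m - 1) (by omega) (p := v) (v := v + 1) (S := S) (by omega) (by
      refine ⟨fun c hc => ?_, hx⟩
      have := hb c hc
      have : c.1 ≠ p := fun h => hp ⟨c.2, by rw [← h]; exact hc⟩
      omega)
    exact ⟨level t, by simp only [size]; omega, ht'⟩

theorem steep_iff_mem_chords (t : SchroderTree) {p v : ℕ} (hpv : p < v) :
    t.Steep ↔ t.size = 0 ∨ (p, v + t.size) ∈ t.chords p v := by
  induction t generalizing p v with
  | nil => simp [Steep, size]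
  | level t ih =>
    simp only [Steep, size, notMem_chords_level t hpv]
    simp
  | hill s t ihs iht =>
    have hs : ∀ w, (p, w) ∉ s.chords v (v + 1) := fun w h => notMem_chords_level s hpv h
    have e : v + (s.size + t.size + 1) = v + s.size + 1 + t.size := by omega
    simp only [Steep, iht (p := p) (v := v + s.size + 1) (by omega), size, chords,
      Finset.mem_insert, Finset.mem_union, e, hs]
    simp

end SchroderTree

theorem bijOn_chords (n i : ℕ) (hn : 1 ≤ n) :
    Set.BijOn (fun t : SchroderTree => (t.chords 1 2).erase (1, n + 2))
      {t | t.size = n ∧ t.hills = i + 1 ∧ t.Steep} (DisSet (n + 2) i) := by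
  have hmem : ∀ t : SchroderTree, t.size = n → t.Steep → (1, n + 2) ∈ t.chords 1 2 := by
    intro t ht hst
    have h := (t.steep_iff_mem_chords (p := 1) (v := 2) (by omega)).1 hst
    rw [ht, add_comm 2 n] at h
    exact h.resolve_left (by omega)
  refine ⟨?_, ?_, ?_⟩
  · rintro t ⟨ht, hh, hst⟩
    obtain ⟨hb, hx⟩ := t.isChordFamily_chords (p := 1) (v := 2) (by omega)
    refine ⟨⟨fun c hc => ?_, fun c hc d hd _ =>
      hx c (Finset.mem_of_mem_erase hc) d (Finset.mem_of_mem_erase hd)⟩, ?_⟩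
    · have h₁ := hb c (Finset.mem_of_mem_erase hc)
      have h₂ : ¬(c.1 = 1 ∧ c.2 = n + 2) := fun h => Finset.ne_of_mem_erase hc (Prod.ext h.1 h.2)
      refine ⟨?_, ?_, ?_, h₂⟩ <;> omega
    · rw [Finset.card_erase_of_mem (hmem t ht hst), t.card_chords (by omega), hh]
      rfl
  · rintro t ⟨ht, -, hst⟩ t' ⟨ht', -, hst'⟩ h
    refine t.chords_injective t' (p := 1) (v := 2) (by omega) (by omega) ?_
    rw [← Finset.insert_erase (hmem t ht hst), ← Finset.insert_erase (hmem t' ht' hst')]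
    exact congrArg _ h
  · rintro S ⟨⟨hc, hx⟩, hcard⟩
    have hnot : (1, n + 2) ∉ S := fun h => (hc _ h).2.2.2 ⟨rfl, rfl⟩
    obtain ⟨t, ht, ht'⟩ := SchroderTree.exists_chords_eq n (p := 1) (v := 2)
      (S := insert (1, n + 2) S) (by omega) (by
        refine ⟨?_, ?_⟩
        · simp only [Finset.forall_mem_insert]
          refine ⟨⟨Or.inl ⟨trivial, by omega⟩, by omega⟩, fun c h => ?_⟩
          obtain ⟨h₁, h₂, h₃, -⟩ := hc c h
          omega
        · have key : ∀ c ∈ S, ¬Crosses (1, n + 2) c ∧ ¬Crosses c (1, n + 2) := by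
            intro c h
            obtain ⟨h₁, h₂, h₃, -⟩ := hc c h
            simp only [Crosses]
            omega
          intro c h d h'
          rcases Finset.mem_insert.1 h with rfl | h <;> rcases Finset.mem_insert.1 h' with rfl | h'
          · simp [Crosses]
          · exact (key d h').1
          · exact (key c h).2
          · by_cases hcd : c = d
            · subst hcd
              simp only [Crosses]
              omega
            · exact hx c h d h' hcd)
    refine ⟨t, ⟨ht, ?_, ?_⟩, ?_⟩
    · rw [← t.card_chords (p := 1) (v := 2) (by omega), ht', Finset.card_insert_of_notMem hnot,
        hcard]
    · rw [t.steep_iff_mem_chords (p := 1) (v := 2) (by omega), ht, ht', add_comm 2 n]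
      exact Or.inr (Finset.mem_insert_self _ _)
    · simp only [ht', Finset.erase_insert hnot]

/-! ## Schröder words -/

/-- Letters of Schröder words: up-step, down-step and level step. -/
inductive SchroderLetter
  | up : SchroderLetter
  | down : SchroderLetter
  | flat : SchroderLetter
  deriving DecidableEq

section

open SchroderLetter

/-- The first letter other than `up`, if any, is `down`. -/
def StartsSteep : List SchroderLetter → Prop
  | [] => True
  | up :: w => StartsSteep w
  | down :: _ => True
  | flat :: _ => False

/-- Words with `u` up-steps, `u` down-steps and `e` level steps staying weakly above height `0`
and having no level step before the first down-step. -/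
structure IsSteepWord (u e : ℕ) (w : List SchroderLetter) : Prop where
  count_up : w.count up = u
  count_down : w.count down = u
  count_flat : w.count flat = e
  ballot : ∀ k, (w.take k).count down ≤ (w.take k).count up
  steep : StartsSteep w

theorem startsSteep_append_down (w r : List SchroderLetter) :
    StartsSteep (w ++ down :: r) ↔ StartsSteep w := by
  induction w with
  | nil => simp [StartsSteep]
  | cons x w ih => cases x <;> simp [StartsSteep, ih]

theorem startsSteep_iff (w : List SchroderLetter) :
    StartsSteep w ↔ ∀ k : ℕ, w[k]? = some flat → ∃ j : ℕ, j < k ∧ w[j]? = some down := by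
  induction w with
  | nil => simp [StartsSteep]
  | cons x w ih =>
    cases x with
    | up =>
      rw [StartsSteep, ih]
      constructor
      · rintro h (_ | k) hk
        · simp at hk
        · obtain ⟨j, hj, hj'⟩ := h k (by simpa using hk)
          exact ⟨j + 1, by omega, by simpa using hj'⟩
      · intro h k hk
        obtain ⟨_ | j, hj, hj'⟩ := h (k + 1) (by simpa using hk)
        · simp at hj'
        · exact ⟨j, by omega, by simpa using hj'⟩
    | down =>
      simp only [StartsSteep, true_iff]
      rintro (_ | k) hk
      · simp at hk
      · exact ⟨0, by omega, by simp⟩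
    | flat =>
      simp only [StartsSteep, false_iff]
      intro h
      obtain ⟨j, hj, -⟩ := h 0 (by simp)
      omega

namespace SchroderTree

/-- The Schröder word of a tree. -/
def word : SchroderTree → List SchroderLetter
  | nil => []
  | level t => flat :: t.word
  | hill s t => up :: (t.word ++ down :: s.word)

/-- One step of the right-to-left parser of Schröder words. -/
def parseStep : SchroderLetter → List SchroderTree → List SchroderTree
  | down, l => nil :: l
  | flat, t :: l => level t :: l
  | up, t :: s :: l => hill s t :: l
  | _, l => l

theorem foldr_parseStep_word (t : SchroderTree) (l : List SchroderTree) :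
    t.word.foldr parseStep (nil :: l) = t :: l := by
  induction t generalizing l with
  | nil => rfl
  | level t ih => simp [word, ih, parseStep]
  | hill s t ihs iht => simp [word, ihs, iht, parseStep]

theorem word_injective : Function.Injective word := by
  intro s t h
  have := foldr_parseStep_word s []
  rw [h, foldr_parseStep_word] at this
  simpa using this.symm

theorem exists_word_append_eq (w : List SchroderLetter)
    (hw : ∀ k, (w.drop k).count up ≤ (w.drop k).count down) :
    ∃ (t : SchroderTree) (l : List SchroderTree),
      w = t.word ++ l.flatMap (fun s => down :: s.word) ∧
        w.count down = w.count up + l.length := by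
  induction w with
  | nil => exact ⟨nil, [], rfl, rfl⟩
  | cons x w ih =>
    obtain ⟨t, l, h, hl⟩ := ih fun k => by simpa using hw (k + 1)
    cases x with
    | up =>
      have h₀ := hw 0
      cases l with
      | nil => simp at h₀ hl; omega
      | cons s l =>
        refine ⟨hill s t, l, by simp [word, h], ?_⟩
        simp at hl ⊢
        omega
    | down =>
      refine ⟨nil, t :: l, by simp [word, h], ?_⟩
      simp at hl ⊢
      omega
    | flat =>
      refine ⟨level t, l, by simp [word, h], ?_⟩
      simpa using hl

theorem count_up_word (t : SchroderTree) : t.word.count up = t.hills := by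
  induction t with
  | nil => rfl
  | level t ih => simp [word, hills, ih]
  | hill s t ihs iht => simp [word, hills, ihs, iht]; omega

theorem count_down_word (t : SchroderTree) : t.word.count down = t.hills := by
  induction t with
  | nil => rfl
  | level t ih => simp [word, hills, ih]
  | hill s t ihs iht => simp [word, hills, ihs, iht]; omega

theorem hills_add_count_flat_word (t : SchroderTree) :
    t.hills + t.word.count flat = t.size := by
  induction t with
  | nil => rfl
  | level t ih => simp [word, hills, size, ← ih]; omega
  | hill s t ihs iht => simp [word, hills, size, ← ihs, ← iht]; omega

theorem ballot_word (t : SchroderTree) (k : ℕ) :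
    (t.word.take k).count down ≤ (t.word.take k).count up := by
  induction t generalizing k with
  | nil => simp [word]
  | level t ih =>
    cases k with
    | zero => simp
    | succ k => simpa [word] using ih k
  | hill s t ihs iht =>
    cases k with
    | zero => simp
    | succ k =>
      have := iht k
      rw [word, List.take_succ_cons, List.take_append]
      cases k - t.word.length with
      | zero => simp; omega
      | succ m =>
        have := ihs m
        simp
        omega

theorem startsSteep_word (t : SchroderTree) : StartsSteep t.word ↔ t.Steep := by
  induction t with
  | nil => rfl
  | level t ih => rfl
  | hill s t ihs iht => rw [word, StartsSteep, startsSteep_append_down, iht, Steep]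

end SchroderTree

theorem bijOn_word (u e : ℕ) :
    Set.BijOn SchroderTree.word {t | t.size = u + e ∧ t.hills = u ∧ t.Steep}
      {w | IsSteepWord u e w} := by
  refine ⟨?_, SchroderTree.word_injective.injOn, ?_⟩
  · rintro t ⟨h₁, h₂, h₃⟩
    have := t.hills_add_count_flat_word
    exact ⟨t.count_up_word.trans h₂, t.count_down_word.trans h₂, by omega, t.ballot_word,
      t.startsSteep_word.2 h₃⟩
  · rintro w ⟨h₁, h₂, h₃, h₄, h₅⟩
    obtain ⟨t, l, h, hl⟩ := SchroderTree.exists_word_append_eq w fun k => by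
      have h₆ := h₄ k
      have h₇ := List.count_append (a := up) (l₁ := w.take k) (l₂ := w.drop k)
      have h₈ := List.count_append (a := down) (l₁ := w.take k) (l₂ := w.drop k)
      rw [List.take_append_drop] at h₇ h₈
      omega
    obtain rfl : l = [] := List.length_eq_zero_iff.1 (by omega)
    obtain rfl : w = t.word := by simpa using h
    have := t.hills_add_count_flat_word
    rw [t.count_up_word] at h₁
    exact ⟨t, ⟨by omega, h₁, t.startsSteep_word.1 h₅⟩, rfl⟩

/-! ## Tableaux -/

theorem Nat.count_eq_card_of_strictMonoOn {p : ℕ → Prop} [DecidablePred p] {g : ℕ → ℕ} {m : ℕ}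
    (hg : StrictMonoOn g (Set.Iio m)) (hp : ∀ k, p k ↔ ∃ j < m, g j = k) (x : ℕ) :
    Nat.count p x = ((Finset.range m).filter fun j => g j < x).card := by
  rw [Nat.count_eq_card_filter_range,
    ← Finset.card_image_of_injOn (s := (Finset.range m).filter fun j => g j < x) (f := g)]
  · congr 1
    ext k
    simp only [Finset.mem_filter, Finset.mem_range, Finset.mem_image, hp]
    constructor
    · rintro ⟨hk, j, hj, rfl⟩
      exact ⟨j, ⟨hj, hk⟩, rfl⟩
    · rintro ⟨j, ⟨hj, hk⟩, rfl⟩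
      exact ⟨hk, j, hj, rfl⟩
  · intro a ha b hb h
    simp only [Finset.coe_filter, Finset.mem_range, Set.mem_ofPred_eq] at ha hb
    exact hg.injOn ha.1 hb.1 h

theorem Nat.nth_eq_of_strictMonoOn {p : ℕ → Prop} {g : ℕ → ℕ} {m j : ℕ}
    (hg : StrictMonoOn g (Set.Iio m)) (hp : ∀ k, p k ↔ ∃ j < m, g j = k) (hj : j < m) :
    Nat.nth p j = g j := by
  classical
  have h : Nat.count p (g j) = j := by
    rw [Nat.count_eq_card_of_strictMonoOn hg hp]
    have : ((Finset.range m).filter fun a => g a < g j) = Finset.range j := by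
      ext a
      simp only [Finset.mem_filter, Finset.mem_range]
      constructor
      · rintro ⟨ha, h⟩
        exact (hg.lt_iff_lt ha hj).1 h
      · intro h
        exact ⟨h.trans hj, hg (h.trans hj) hj h⟩
    rw [this, Finset.card_range]
  have := Nat.nth_count ((hp (g j)).2 ⟨j, hj, rfl⟩)
  rwa [h] at this

section LetterPositions

variable {α : Type*}

/-- The position, counted from `1`, of the `j`-th occurrence of `x` in `w`. -/
noncomputable def letterPos (w : List α) (x : α) (j : ℕ) : ℕ :=
  Nat.nth (fun k => w[k]? = some x) j + 1

theorem one_le_letterPos {w : List α} {x : α} (j : ℕ) : 1 ≤ letterPos w x j := Nat.succ_pos _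

variable [DecidableEq α]

theorem List.natCount_getElem?_eq (w : List α) (x : α) (k : ℕ) :
    Nat.count (fun k => w[k]? = some x) k = (w.take k).count x := by
  induction k with
  | zero => simp
  | succ k ih =>
    rw [Nat.count_succ, ih, List.take_add_one, List.count_append]
    rcases h : w[k]? with _ | y
    · simp
    · by_cases hy : y = x <;> simp [hy]

theorem List.lt_card_getElem?_eq (w : List α) (x : α) {j : ℕ} (hj : j < w.count x)
    (hf : (Set.ofPred fun k : ℕ => w[k]? = some x).Finite) : j < hf.toFinset.card := by
  have h := w.natCount_getElem?_eq x w.length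
  rw [List.take_length, Nat.count_eq_card_filter_range] at h
  rw [← h] at hj
  refine hj.trans_le (Finset.card_le_card fun k hk => ?_)
  rw [Set.Finite.mem_toFinset]
  exact (Finset.mem_filter.1 hk).2

variable {w : List α} {x : α}

theorem getElem?_letterPos {j : ℕ} (hj : j < w.count x) :
    w[letterPos w x j - 1]? = some x :=
  Nat.nth_mem (p := fun k => w[k]? = some x) j (w.lt_card_getElem?_eq x hj)

theorem letterPos_le_length {j : ℕ} (hj : j < w.count x) : letterPos w x j ≤ w.length := by
  have h := (List.getElem?_eq_some_iff.1 (getElem?_letterPos hj)).1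
  omega

theorem letterPos_lt_letterPos {j k : ℕ} (hjk : j < k) (hk : k < w.count x) :
    letterPos w x j < letterPos w x k :=
  Nat.succ_lt_succ (Nat.nth_lt_nth' hjk (w.lt_card_getElem?_eq x hk))

theorem letterPos_injOn {j k : ℕ} (hj : j < w.count x) (hk : k < w.count x)
    (h : letterPos w x j = letterPos w x k) : j = k := by
  rcases lt_trichotomy j k with h' | h' | h'
  · exact absurd h (letterPos_lt_letterPos h' hk).ne
  · exact h'
  · exact absurd h (letterPos_lt_letterPos h' hj).ne'

theorem eq_of_letterPos_eq {y : α} {j k : ℕ} (hj : j < w.count x) (hk : k < w.count y)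
    (h : letterPos w x j = letterPos w y k) : x = y := by
  have h₁ := getElem?_letterPos hj
  rw [h, getElem?_letterPos hk] at h₁
  exact (Option.some.inj h₁).symm

theorem letterPos_count_take {k : ℕ} (h : w[k]? = some x) :
    letterPos w x ((w.take k).count x) = k + 1 := by
  rw [← List.natCount_getElem?_eq, letterPos, Nat.nth_count (p := fun k => w[k]? = some x) h]

theorem count_take_letterPos_sub_one {j : ℕ} (hj : j < w.count x) :
    (w.take (letterPos w x j - 1)).count x = j := by
  rw [← List.natCount_getElem?_eq]
  exact Nat.count_nth (p := fun k => w[k]? = some x) (w.lt_card_getElem?_eq x hj)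

theorem count_take_lt_count {k : ℕ} (h : w[k]? = some x) : (w.take k).count x < w.count x := by
  have h₁ : (w.take (k + 1)).count x = (w.take k).count x + 1 := by
    simp [List.take_add_one, h]
  have h₂ := (List.take_sublist (k + 1) w).count_le x
  omega

theorem exists_letterPos_eq_iff {k : ℕ} :
    (∃ j < w.count x, letterPos w x j = k + 1) ↔ w[k]? = some x := by
  constructor
  · rintro ⟨j, hj, h⟩
    simpa [h] using getElem?_letterPos hj
  · intro h
    exact ⟨_, count_take_lt_count h, letterPos_count_take h⟩

end LetterPositions

theorem SchroderLetter.length_eq_count (w : List SchroderLetter) :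
    w.length = w.count up + w.count down + w.count flat := by
  induction w with
  | nil => rfl
  | cons x w ih => cases x <;> simp [ih] <;> omega

namespace IsSteepWord

variable {u e : ℕ} {w : List SchroderLetter}

theorem letterPos_up_lt_down (hw : IsSteepWord u e w) {j : ℕ} (hj : j < u) :
    letterPos w up j < letterPos w down j := by
  have hu : j < w.count up := by rwa [hw.count_up]
  have hd : j < w.count down := by rwa [hw.count_down]
  by_contra! h
  have h₁ := hw.ballot (letterPos w down j)
  have h₂ : (w.take (letterPos w down j)).count down = j + 1 := by
    have h₃ := getElem?_letterPos hd
    have h₄ := count_take_letterPos_sub_one hd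
    have h₅ := one_le_letterPos (w := w) (x := down) j
    obtain ⟨k, hk⟩ : ∃ k, letterPos w down j = k + 1 := ⟨letterPos w down j - 1, by omega⟩
    rw [hk, Nat.add_sub_cancel] at h₃ h₄
    rw [hk, List.take_add_one, List.count_append, h₄, h₃]
    simp
  have h₃ := count_take_letterPos_sub_one hu
  have h₄ : letterPos w down j ≠ letterPos w up j := fun h => by
    simpa using eq_of_letterPos_eq hd hu h
  have h₅ : (w.take (letterPos w down j)).count up ≤
      (w.take (letterPos w up j - 1)).count up :=
    (List.take_sublist_take_left (by omega)).count_le _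
  omega

theorem letterPos_down_zero_lt_flat (hw : IsSteepWord u e w) {j : ℕ} (hj : j < e) :
    letterPos w down 0 < letterPos w flat j := by
  have hf : j < w.count flat := by rwa [hw.count_flat]
  obtain ⟨k, hk, hk'⟩ := (startsSteep_iff w).1 hw.steep _ (getElem?_letterPos hf)
  have h₁ := letterPos_count_take hk'
  rcases Nat.eq_zero_or_pos ((w.take k).count down) with h₂ | h₂
  · rw [h₂] at h₁
    omega
  · have := letterPos_lt_letterPos h₂ (count_take_lt_count hk')
    omega

end IsSteepWord

theorem mem_skytCells_two {a i : ℕ} {c : ℕ × ℕ} :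
    c ∈ skytCells a i 2 ↔ c.1 < a ∧ c.2 ≤ i ∧ (2 ≤ c.1 → c.2 = 0) := by
  simp only [skytCells, Finset.mem_filter, Finset.mem_product, Finset.mem_range]
  omega

/-- The filling whose two rows record the positions of the up- and down-steps of a word, and whose
remaining column records the positions of the level steps. -/
noncomputable def wordTableau (a i : ℕ) (w : List SchroderLetter) (c : ℕ × ℕ) : ℕ :=
  if c ∈ skytCells a i 2 then
    if c.1 = 0 then letterPos w up c.2
    else if c.1 = 1 then letterPos w down c.2
    else letterPos w flat (c.1 - 2)
  else 0

theorem forall_mem_skytCells_two {a i : ℕ} (ha : 2 ≤ a) {P : ℕ × ℕ → Prop} :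
    (∀ c ∈ skytCells a i 2, P c) ↔
      (∀ j < i + 1, P (0, j)) ∧ (∀ j < i + 1, P (1, j)) ∧ ∀ j < a - 2, P (j + 2, 0) := by
  simp only [mem_skytCells_two]
  constructor
  · intro h
    exact ⟨fun j hj => h _ (by dsimp only; omega), fun j hj => h _ (by dsimp only; omega),
      fun j hj => h _ (by dsimp only; omega)⟩
  · rintro ⟨h₀, h₁, h₂⟩ ⟨_ | _ | r, j⟩ ⟨hr, hj, hrj⟩
    · exact h₀ j (by dsimp only at hj; omega)
    · exact h₁ j (by dsimp only at hj; omega)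
    · obtain rfl : j = 0 := hrj (by dsimp only; omega)
      exact h₂ r (by dsimp only at hr; omega)

section WordTableau

variable {a i : ℕ} (w : List SchroderLetter)

theorem wordTableau_zero (ha : 2 ≤ a) {j : ℕ} (hj : j < i + 1) :
    wordTableau a i w (0, j) = letterPos w up j := by
  rw [wordTableau, if_pos (mem_skytCells_two.2 (by dsimp only; omega)), if_pos rfl]

theorem wordTableau_one (ha : 2 ≤ a) {j : ℕ} (hj : j < i + 1) :
    wordTableau a i w (1, j) = letterPos w down j := by
  rw [wordTableau, if_pos (mem_skytCells_two.2 (by dsimp only; omega)), if_neg (by simp),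
    if_pos rfl]

theorem wordTableau_add_two {j : ℕ} (hj : j < a - 2) :
    wordTableau a i w (j + 2, 0) = letterPos w flat j := by
  rw [wordTableau, if_pos (mem_skytCells_two.2 (by dsimp only; omega)), if_neg (by simp),
    if_neg (by simp)]
  rfl

end WordTableau

theorem wordTableau_mem_skytSet {a i : ℕ} (ha : 2 ≤ a) {w : List SchroderLetter}
    (hw : IsSteepWord (i + 1) (a - 2) w) : wordTableau a i w ∈ SkytSet a i 2 := by
  have hlen : w.length = a + 2 + 2 * i - 2 := by
    rw [SchroderLetter.length_eq_count, hw.count_up, hw.count_down, hw.count_flat]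
    omega
  have t₀ := fun j (hj : j < i + 1) => wordTableau_zero (a := a) w ha hj
  have t₁ := fun j (hj : j < i + 1) => wordTableau_one (a := a) w ha hj
  have t₂ := fun j (hj : j < a - 2) => wordTableau_add_two (i := i) w hj
  have c₀ : ∀ j, j < i + 1 → j < w.count up := fun j hj => by rwa [hw.count_up]
  have c₁ : ∀ j, j < i + 1 → j < w.count down := fun j hj => by rwa [hw.count_down]
  have c₂ : ∀ j, j < a - 2 → j < w.count flat := fun j hj => by rwa [hw.count_flat]
  refine ⟨fun c hc => if_neg hc, ⟨?_, ?_, ?_⟩, ?_, ?_⟩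
  · intro c hc
    revert c
    simp only [Finset.mem_coe, Finset.mem_Icc]
    rw [forall_mem_skytCells_two ha, ← hlen]
    refine ⟨fun j hj => ?_, fun j hj => ?_, fun j hj => ?_⟩
    · rw [t₀ j hj]
      exact ⟨one_le_letterPos j, letterPos_le_length (c₀ j hj)⟩
    · rw [t₁ j hj]
      exact ⟨one_le_letterPos j, letterPos_le_length (c₁ j hj)⟩
    · rw [t₂ j hj]
      exact ⟨one_le_letterPos j, letterPos_le_length (c₂ j hj)⟩
  · change ∀ c ∈ skytCells a i 2, ∀ d ∈ skytCells a i 2, _ → c = d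
    simp only [forall_mem_skytCells_two ha]
    refine ⟨fun j hj => ⟨fun k hk => ?_, fun k hk => ?_, fun k hk => ?_⟩,
      fun j hj => ⟨fun k hk => ?_, fun k hk => ?_, fun k hk => ?_⟩,
      fun j hj => ⟨fun k hk => ?_, fun k hk => ?_, fun k hk => ?_⟩⟩ <;> intro h <;>
      simp only [t₀, t₁, t₂, hj, hk] at h
    · rw [letterPos_injOn (c₀ j hj) (c₀ k hk) h]
    · cases eq_of_letterPos_eq (c₀ j hj) (c₁ k hk) h
    · cases eq_of_letterPos_eq (c₀ j hj) (c₂ k hk) h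
    · cases eq_of_letterPos_eq (c₁ j hj) (c₀ k hk) h
    · rw [letterPos_injOn (c₁ j hj) (c₁ k hk) h]
    · cases eq_of_letterPos_eq (c₁ j hj) (c₂ k hk) h
    · cases eq_of_letterPos_eq (c₂ j hj) (c₀ k hk) h
    · cases eq_of_letterPos_eq (c₂ j hj) (c₁ k hk) h
    · rw [letterPos_injOn (c₂ j hj) (c₂ k hk) h]
  · intro k hk
    simp only [Finset.mem_coe, Finset.mem_Icc] at hk
    obtain ⟨k, rfl⟩ : ∃ m, k = m + 1 := ⟨k - 1, by omega⟩
    have hk' : k < w.length := by omega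
    obtain ⟨j, hj, hjk⟩ := exists_letterPos_eq_iff.2 (List.getElem?_eq_getElem hk')
    generalize w[k] = x at hj hjk
    cases x with
    | up =>
      rw [hw.count_up] at hj
      exact ⟨(0, j), mem_skytCells_two.2 (by dsimp only; omega), (t₀ j hj).trans hjk⟩
    | down =>
      rw [hw.count_down] at hj
      exact ⟨(1, j), mem_skytCells_two.2 (by dsimp only; omega), (t₁ j hj).trans hjk⟩
    | flat =>
      rw [hw.count_flat] at hj
      exact ⟨(j + 2, 0), mem_skytCells_two.2 (by dsimp only; omega), (t₂ j hj).trans hjk⟩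
  · simp only [forall_mem_skytCells_two ha]
    refine ⟨fun j hj => ⟨fun k hk => ?_, fun k hk => ?_, fun k hk => ?_⟩,
      fun j hj => ⟨fun k hk => ?_, fun k hk => ?_, fun k hk => ?_⟩,
      fun j hj => ⟨fun k hk => ?_, fun k hk => ?_, fun k hk => ?_⟩⟩ <;> intro h h' <;>
      simp only [t₀, t₁, t₂, hj, hk] <;> try omega
    · exact letterPos_lt_letterPos h' (c₀ k hk)
    · exact letterPos_lt_letterPos h' (c₁ k hk)
  · simp only [forall_mem_skytCells_two ha]
    refine ⟨fun j hj => ⟨fun k hk => ?_, fun k hk => ?_, fun k hk => ?_⟩,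
      fun j hj => ⟨fun k hk => ?_, fun k hk => ?_, fun k hk => ?_⟩,
      fun j hj => ⟨fun k hk => ?_, fun k hk => ?_, fun k hk => ?_⟩⟩ <;> intro h h' <;>
      simp only [t₀, t₁, t₂, hj, hk] <;> try omega
    · rw [h]
      exact hw.letterPos_up_lt_down hk
    · rw [h]
      exact (hw.letterPos_up_lt_down (Nat.succ_pos i)).trans (hw.letterPos_down_zero_lt_flat hk)
    · rw [h]
      exact hw.letterPos_down_zero_lt_flat hk
    · exact letterPos_lt_letterPos (by omega) (c₂ k hk)

theorem wordTableau_injOn {a i : ℕ} (ha : 2 ≤ a) :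
    Set.InjOn (wordTableau a i) {w | IsSteepWord (i + 1) (a - 2) w} := by
  intro w hw w' hw' h
  have key : ∀ (x : SchroderLetter) (k : ℕ), w[k]? = some x ↔ w'[k]? = some x := by
    intro x k
    rw [← exists_letterPos_eq_iff, ← exists_letterPos_eq_iff]
    cases x with
    | up =>
      rw [hw.count_up, hw'.count_up]
      refine exists_congr fun j => and_congr_right fun hj => ?_
      rw [← wordTableau_zero w ha hj, ← wordTableau_zero w' ha hj, h]
    | down =>
      rw [hw.count_down, hw'.count_down]
      refine exists_congr fun j => and_congr_right fun hj => ?_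
      rw [← wordTableau_one w ha hj, ← wordTableau_one w' ha hj, h]
    | flat =>
      rw [hw.count_flat, hw'.count_flat]
      refine exists_congr fun j => and_congr_right fun hj => ?_
      rw [← wordTableau_add_two (i := i) w hj, ← wordTableau_add_two (i := i) w' hj, h]
  exact List.ext_getElem? fun k => Option.ext fun x => by simpa using key x k

theorem exists_wordTableau_eq {a i : ℕ} (ha : 2 ≤ a) {f : ℕ × ℕ → ℕ} (hf : f ∈ SkytSet a i 2) :
    ∃ w, IsSteepWord (i + 1) (a - 2) w ∧ wordTableau a i w = f := by
  classical
  obtain ⟨h₀, ⟨hmaps, hinj, hsurj⟩, hrow, hcol⟩ := hf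
  have hN : a + 2 + 2 * i - 2 = a + 2 * i := by omega
  rw [hN] at hmaps hsurj
  set N := a + 2 * i with hNdef
  have hcell₀ : ∀ j < i + 1, (0, j) ∈ skytCells a i 2 := fun j hj =>
    mem_skytCells_two.2 (by dsimp only; omega)
  have hcell₁ : ∀ j < i + 1, (1, j) ∈ skytCells a i 2 := fun j hj =>
    mem_skytCells_two.2 (by dsimp only; omega)
  have hcell₂ : ∀ j < a - 2, (j + 2, 0) ∈ skytCells a i 2 := fun j hj =>
    mem_skytCells_two.2 (by dsimp only; omega)
  have hbd : ∀ c ∈ skytCells a i 2, 1 ≤ f c ∧ f c ≤ N := fun c hc => by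
    simpa using hmaps hc
  let w : List SchroderLetter := (List.range N).map fun k =>
    if ∃ j < i + 1, f (0, j) = k + 1 then up
    else if ∃ j < i + 1, f (1, j) = k + 1 then down else flat
  have hwlen : w.length = N := by simp [w]
  have hwget : ∀ k < N, w[k]? = some (if ∃ j < i + 1, f (0, j) = k + 1 then up
      else if ∃ j < i + 1, f (1, j) = k + 1 then down else flat) := by
    intro k hk
    simp only [w, List.getElem?_map, List.getElem?_range hk, Option.map_some]
  have hwnone : ∀ k x, w[k]? = some x → k < N := by
    intro k x h
    rw [← hwlen]
    exact (List.getElem?_eq_some_iff.1 h).1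
  have up_iff : ∀ k : ℕ, w[k]? = some up ↔ ∃ j < i + 1, f (0, j) - 1 = k := by
    intro k
    constructor
    · intro h
      rw [hwget k (hwnone k _ h), Option.some.injEq] at h
      split_ifs at h with h₁
      obtain ⟨j, hj, hjk⟩ := h₁
      exact ⟨j, hj, by omega⟩
    · rintro ⟨j, hj, hjk⟩
      have := hbd _ (hcell₀ j hj)
      rw [hwget k (by omega), if_pos ⟨j, hj, by omega⟩]
  have down_iff : ∀ k : ℕ, w[k]? = some down ↔ ∃ j < i + 1, f (1, j) - 1 = k := by
    intro k
    constructor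
    · intro h
      rw [hwget k (hwnone k _ h), Option.some.injEq] at h
      split_ifs at h with h₁ h₂
      obtain ⟨j, hj, hjk⟩ := h₂
      exact ⟨j, hj, by omega⟩
    · rintro ⟨j, hj, hjk⟩
      have := hbd _ (hcell₁ j hj)
      rw [hwget k (by omega), if_neg, if_pos ⟨j, hj, by omega⟩]
      rintro ⟨j', hj', h⟩
      have := hinj (hcell₀ j' hj') (hcell₁ j hj) (by omega)
      simp at this
  have flat_iff : ∀ k : ℕ, w[k]? = some flat ↔ ∃ j < a - 2, f (j + 2, 0) - 1 = k := by
    intro k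
    constructor
    · intro h
      have hk := hwnone k _ h
      rw [hwget k hk, Option.some.injEq] at h
      split_ifs at h with h₁ h₂
      obtain ⟨⟨r, j⟩, hc, hck⟩ := hsurj (by simp; omega : k + 1 ∈ (Finset.Icc 1 N : Set ℕ))
      have hc' := mem_skytCells_two.1 hc
      simp only at hc'
      rcases r with _ | _ | r
      · exact absurd ⟨j, by omega, hck⟩ h₁
      · exact absurd ⟨j, by omega, hck⟩ h₂
      · obtain rfl : j = 0 := by omega
        exact ⟨r, by omega, Nat.sub_eq_of_eq_add hck⟩
    · rintro ⟨j, hj, hjk⟩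
      have := hbd _ (hcell₂ j hj)
      rw [hwget k (by omega), if_neg, if_neg]
      · rintro ⟨j', hj', h⟩
        have := hinj (hcell₁ j' hj') (hcell₂ j hj) (by omega)
        simp at this
      · rintro ⟨j', hj', h⟩
        have := hinj (hcell₀ j' hj') (hcell₂ j hj) (by omega)
        simp at this
  have up_mono : StrictMonoOn (fun j => f (0, j) - 1) (Set.Iio (i + 1)) := by
    intro j hj k hk hjk
    have := hrow _ (hcell₀ j hj) _ (hcell₀ k hk) rfl hjk
    have := hbd _ (hcell₀ j hj)
    dsimp only
    omega
  have down_mono : StrictMonoOn (fun j => f (1, j) - 1) (Set.Iio (i + 1)) := by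
    intro j hj k hk hjk
    have := hrow _ (hcell₁ j hj) _ (hcell₁ k hk) rfl hjk
    have := hbd _ (hcell₁ j hj)
    dsimp only
    omega
  have flat_mono : StrictMonoOn (fun j => f (j + 2, 0) - 1) (Set.Iio (a - 2)) := by
    intro j hj k hk hjk
    have := hcol _ (hcell₂ j hj) _ (hcell₂ k hk) rfl (Nat.add_lt_add_right hjk 2)
    have := hbd _ (hcell₂ j hj)
    dsimp only
    omega
  have count_eq : ∀ (x : SchroderLetter) (g : ℕ → ℕ) (m : ℕ), StrictMonoOn g (Set.Iio m) →
      (∀ k : ℕ, w[k]? = some x ↔ ∃ j < m, g j = k) → w.count x = m := by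
    intro x g m hg hx
    have h := w.natCount_getElem?_eq x N
    rw [Nat.count_eq_card_of_strictMonoOn hg hx, ← hwlen, List.take_length] at h
    rw [← h, Finset.filter_true_of_mem, Finset.card_range]
    intro j hj
    rw [hwlen]
    exact hwnone _ _ ((hx _).2 ⟨j, Finset.mem_range.1 hj, rfl⟩)
  refine ⟨w, ⟨count_eq _ _ _ up_mono up_iff, count_eq _ _ _ down_mono down_iff,
    count_eq _ _ _ flat_mono flat_iff, fun k => ?_, ?_⟩, ?_⟩
  · rw [← List.natCount_getElem?_eq, ← List.natCount_getElem?_eq,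
      Nat.count_eq_card_of_strictMonoOn down_mono down_iff,
      Nat.count_eq_card_of_strictMonoOn up_mono up_iff]
    refine Finset.card_le_card fun j hj => ?_
    simp only [Finset.mem_filter, Finset.mem_range] at hj ⊢
    have := hcol _ (hcell₀ j hj.1) _ (hcell₁ j hj.1) rfl (by simp)
    omega
  · rw [startsSteep_iff]
    intro k hk
    obtain ⟨j, hj, hjk⟩ := (flat_iff k).1 hk
    have h₁ := hcol _ (hcell₁ 0 (Nat.succ_pos i)) _ (hcell₂ j hj) rfl (by simp)
    have h₂ := hbd _ (hcell₁ 0 (Nat.succ_pos i))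
    exact ⟨f (1, 0) - 1, by omega, (down_iff _).2 ⟨0, Nat.succ_pos i, rfl⟩⟩
  · funext c
    by_cases hc : c ∈ skytCells a i 2
    · revert c
      rw [forall_mem_skytCells_two ha]
      refine ⟨fun j hj => ?_, fun j hj => ?_, fun j hj => ?_⟩
      · have := hbd _ (hcell₀ j hj)
        rw [wordTableau_zero w ha hj, letterPos, Nat.nth_eq_of_strictMonoOn up_mono up_iff hj]
        omega
      · have := hbd _ (hcell₁ j hj)
        rw [wordTableau_one w ha hj, letterPos, Nat.nth_eq_of_strictMonoOn down_mono down_iff hj]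
        omega
      · have := hbd _ (hcell₂ j hj)
        rw [wordTableau_add_two w hj, letterPos, Nat.nth_eq_of_strictMonoOn flat_mono flat_iff hj]
        omega
    · rw [h₀ c hc, wordTableau, if_neg hc]

theorem bijOn_wordTableau {a i : ℕ} (ha : 2 ≤ a) :
    Set.BijOn (wordTableau a i) {w | IsSteepWord (i + 1) (a - 2) w} (SkytSet a i 2) :=
  ⟨fun _ hw => wordTableau_mem_skytSet ha hw, wordTableau_injOn ha,
    fun _ hf => exists_wordTableau_eq ha hf⟩

end

/-- For all integers `n`, `i` with `1 ≤ i ≤ n - 1`, `Dis(n+2, i)` and `Skyt(n-i+1, i, 2)`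
have the same cardinality. -/
theorem dis_equiv_skyt (n i : ℕ) (hi : 1 ≤ i) (hin : i + 1 ≤ n) :
    Nonempty (↥(DisSet (n + 2) i) ≃ ↥(SkytSet (n - i + 1) i 2)) := by
  have h₁ := bijOn_chords n i (by omega)
  have h₂ := (bijOn_wordTableau (a := n - i + 1) (i := i) (by omega)).comp (bijOn_word _ _)
  rw [show i + 1 + (n - i + 1 - 2) = n by omega] at h₂
  exact ⟨(h₁.equiv _).symm.trans (h₂.equiv _)⟩
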